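/- Fix n ≥ 1 and let G be the n×n matrix with entries G_{ij} = 2/(2i + 2j − 3) for 1 ≤ i, j ≤ n (so G_{ij} = ∫_{-1}^{1} x^{2(i-1)} x^{2(j-1)} dx). Then G is invertible and its inverse B has entries B_{ij} = Σ_{k=max(i,j)}^{n} ((4k − 3)/2) · a_{ki} a_{kj}, where a_{ki} = ((-1)^{k+i} / (k−1)!) · binom(k−1, i−1) · Γ(i − 1/2 + (k−1)) / Γ(i − 1/2). -/

import Mathlib

/-- Coefficients of the even Legendre polynomial `P_{2(k-1)}` in ascending even powers
(indices running from `1`). -/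
noncomputable def evenLegendreCoeff (k i : ℕ) : ℝ :=
  (-1) ^ (k + i) / ((k - 1).factorial : ℝ) * ((k - 1).choose (i - 1) : ℝ) *
    Real.Gamma ((i : ℝ) - 1 / 2 + ((k : ℝ) - 1)) / Real.Gamma ((i : ℝ) - 1 / 2)

open Polynomial in
/-- The `k`-th forward difference of `y ↦ y⁻¹`. -/
theorem fwdDiff_iter_inv (k : ℕ) {y : ℝ} (hy : 0 < y) :
    (fwdDiff (1 : ℝ))^[k] (fun x : ℝ => x⁻¹) y =
      (-1) ^ k * (k.factorial : ℝ) / (ascPochhammer ℝ (k + 1)).eval y := by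
  induction k generalizing y with
  | zero => simp
  | succ k ih =>
    have h1 := ascPochhammer_succ_eval (k + 1) y
    have h2 : (ascPochhammer ℝ (k + 2)).eval y =
        y * (ascPochhammer ℝ (k + 1)).eval (y + 1) := by
      rw [ascPochhammer_succ_left]
      simp
    have p1 := ascPochhammer_pos (k + 1) y hy
    have p2 := ascPochhammer_pos (k + 1) (y + 1) (by linarith)
    have h3 : (k : ℝ) + 1 + y ≠ 0 := by positivity
    have h12 := h1.symm.trans h2
    rw [Function.iterate_succ_apply', fwdDiff, ih (by linarith), ih hy, h2]
    push_cast [Nat.factorial_succ] at h12 ⊢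
    field_simp
    linear_combination (-1) ^ k * h12

open Polynomial in
/-- Partial fractions: the alternating binomial sum of `p(i) / (y + i)` for a polynomial `p` of
degree at most `k`. -/
theorem sum_choose_mul_eval_div (k : ℕ) (p : ℝ[X]) (hp : p.degree ≤ k) {y : ℝ} (hy : 0 < y) :
    ∑ i ∈ Finset.range (k + 1), (-1) ^ (k + i) * (k.choose i : ℝ) * p.eval (i : ℝ) / (y + i) =
      p.eval (-y) * ((-1) ^ k * (k.factorial : ℝ) / (ascPochhammer ℝ (k + 1)).eval y) := by
  set q := p /ₘ (X - C (-y)) with hq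
  have hsign : ∀ i ∈ Finset.range (k + 1), (-1 : ℝ) ^ (k - i) = (-1) ^ (k + i) := by
    intro i hi
    obtain ⟨j, rfl⟩ := Nat.exists_eq_add_of_le (Nat.lt_succ_iff.mp (Finset.mem_range.mp hi))
    rw [Nat.add_sub_cancel_left, show i + j + i = j + 2 * i by ring, pow_add, pow_mul]
    simp
  have hpq : ∀ x, p.eval x = p.eval (-y) + (x + y) * q.eval x := by
    intro x
    have h := congrArg (eval x) (modByMonic_add_div p (X - C (-y)))
    rw [modByMonic_X_sub_C_eq_C_eval] at h
    simp only [eval_add, eval_mul, eval_sub, eval_X, eval_C, ← hq] at h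
    linear_combination -h
  have hq0 : ∑ i ∈ Finset.range (k + 1), (-1) ^ (k + i) * (k.choose i : ℝ) * q.eval (i : ℝ) = 0 := by
    by_cases h0 : q = 0
    · simp [h0]
    have hp0 : p ≠ 0 := by
      rintro rfl
      simp [hq] at h0
    have hdeg : q.natDegree < k := by
      rw [natDegree_lt_iff_degree_lt h0]
      exact (degree_divByMonic_lt p _ hp0 (by rw [degree_X_sub_C]; norm_num)).trans_le hp
    have h := congrFun (fwdDiff_iter_eq_zero_of_degree_lt hdeg) 0
    rw [fwdDiff_iter_eq_sum_shift] at h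
    rw [← show _ = (0 : ℝ) from h]
    refine Finset.sum_congr rfl fun i hi => ?_
    simp [hsign i hi]
  have hinv := fwdDiff_iter_inv k hy
  rw [fwdDiff_iter_eq_sum_shift] at hinv
  rw [← hinv, Finset.mul_sum, ← add_zero (∑ i ∈ _, p.eval (-y) * _), ← hq0,
    ← Finset.sum_add_distrib]
  refine Finset.sum_congr rfl fun i hi => ?_
  have : y + i ≠ 0 := by positivity
  rw [hpq i]
  simp only [zsmul_eq_mul, Int.cast_mul, Int.cast_pow, Int.cast_neg, Int.cast_one,
    Int.cast_natCast, hsign i hi, nsmul_eq_mul, mul_one]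
  field_simp
  ring

/-- The Gamma quotient as a rising factorial. -/
theorem Real.Gamma_add_natCast {x : ℝ} (hx : 0 < x) (k : ℕ) :
    Real.Gamma (x + k) = (ascPochhammer ℝ k).eval x * Real.Gamma x := by
  induction k with
  | zero => simp
  | succ k ih =>
    rw [Nat.cast_succ, ← add_assoc, Real.Gamma_add_one (by positivity), ih,
      ascPochhammer_succ_eval]
    ring

theorem evenLegendreCoeff_succ_succ (k i : ℕ) :
    evenLegendreCoeff (k + 1) (i + 1) =
      (-1) ^ (k + i) / (k.factorial : ℝ) * (k.choose i : ℝ) *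
        (ascPochhammer ℝ k).eval ((i : ℝ) + 1 / 2) := by
  have hx : (0 : ℝ) < (i : ℝ) + 1 / 2 := by positivity
  have hG := (Real.Gamma_pos_of_pos hx).ne'
  rw [evenLegendreCoeff, show ((i + 1 : ℕ) : ℝ) - 1 / 2 = (i : ℝ) + 1 / 2 by push_cast; ring,
    show ((k + 1 : ℕ) : ℝ) - 1 = k by push_cast; ring, Real.Gamma_add_natCast hx,
    show k + 1 + (i + 1) = k + i + 2 by ring, pow_add]
  simp only [Nat.add_sub_cancel]
  field_simp

theorem evenLegendreCoeff_eq_zero {k i : ℕ} (h : k < i) :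
    evenLegendreCoeff (k + 1) (i + 1) = 0 := by
  simp [evenLegendreCoeff_succ_succ, Nat.choose_eq_zero_of_lt h]

open Polynomial in
/-- The moment of order `2m` of the even Legendre polynomial `P_{2k}`. -/
theorem sum_evenLegendreCoeff_div (k m : ℕ) :
    ∑ i ∈ Finset.range (k + 1), evenLegendreCoeff (k + 1) (i + 1) / ((m : ℝ) + 1 / 2 + i) =
      (ascPochhammer ℝ k).eval (-(m : ℝ)) *
        ((-1) ^ k / (ascPochhammer ℝ (k + 1)).eval ((m : ℝ) + 1 / 2)) := by
  have hk : (k.factorial : ℝ) ≠ 0 := by positivity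
  have hdeg : ((ascPochhammer ℝ k).comp (X + C (1 / 2))).degree ≤ k := by
    refine degree_le_of_natDegree_le ?_
    rw [natDegree_comp, ascPochhammer_natDegree, natDegree_X_add_C, mul_one]
  have h := sum_choose_mul_eval_div k _ hdeg (y := (m : ℝ) + 1 / 2) (by positivity)
  simp only [eval_comp, eval_add, eval_X, eval_C] at h
  rw [show -((m : ℝ) + 1 / 2) + 1 / 2 = -m by ring] at h
  have hsum : ∑ i ∈ Finset.range (k + 1),
      evenLegendreCoeff (k + 1) (i + 1) / ((m : ℝ) + 1 / 2 + i) =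
      (k.factorial : ℝ)⁻¹ * ∑ i ∈ Finset.range (k + 1), (-1) ^ (k + i) * (k.choose i : ℝ) *
        (ascPochhammer ℝ k).eval ((i : ℝ) + 1 / 2) / ((m : ℝ) + 1 / 2 + i) := by
    rw [Finset.mul_sum]
    refine Finset.sum_congr rfl fun i _ => ?_
    rw [evenLegendreCoeff_succ_succ]
    ring
  rw [hsum, h]
  field_simp

theorem sum_evenLegendreCoeff_div_of_lt {k m : ℕ} (h : m < k) :
    ∑ i ∈ Finset.range (k + 1), evenLegendreCoeff (k + 1) (i + 1) / ((m : ℝ) + 1 / 2 + i) = 0 := by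
  rw [sum_evenLegendreCoeff_div, ascPochhammer_eval_neg_coe_nat_of_lt h, zero_mul]

theorem evenLegendreCoeff_self_mul_sum (k : ℕ) :
    evenLegendreCoeff (k + 1) (k + 1) *
      ∑ i ∈ Finset.range (k + 1), evenLegendreCoeff (k + 1) (i + 1) / ((k : ℝ) + 1 / 2 + i) =
      2 / (4 * (k : ℝ) + 1) := by
  have hp := (ascPochhammer_pos k ((k : ℝ) + 1 / 2) (by positivity)).ne'
  have hneg : (ascPochhammer ℝ k).eval (-(k : ℝ)) = (-1) ^ k * (k.factorial : ℝ) := by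
    rw [ascPochhammer_eval_neg_eq_descPochhammer, descPochhammer_eval_eq_descFactorial,
      Nat.descFactorial_self]
  have hs : ((-1 : ℝ) ^ k) * (-1) ^ k = 1 := by rw [← mul_pow]; norm_num
  rw [sum_evenLegendreCoeff_div, hneg, evenLegendreCoeff_succ_succ, ascPochhammer_succ_eval,
    pow_add, hs, Nat.choose_self]
  have h4 : (4 * (k : ℝ) + 1) ≠ 0 := by positivity
  have h5 : (k : ℝ) + 1 / 2 + k ≠ 0 := by positivity
  calc _ = (((-1 : ℝ) ^ k) * (-1) ^ k) * ((k : ℝ) + 1 / 2 + k)⁻¹ := by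
        generalize (ascPochhammer ℝ k).eval ((k : ℝ) + 1 / 2) = a at hp ⊢
        field_simp
        simp
    _ = _ := by
        rw [hs]
        field_simp
        ring

/-- The matrix whose rows are the coefficients of the even Legendre polynomials. -/
noncomputable def evenLegendreMatrix (n : ℕ) : Matrix (Fin n) (Fin n) ℝ :=
  Matrix.of fun k i => evenLegendreCoeff ((k : ℕ) + 1) ((i : ℕ) + 1)

theorem evenLegendreMatrix_mul_gram_apply {n : ℕ} (G : Matrix (Fin n) (Fin n) ℝ)
    (hG : ∀ i j : Fin n,
      G i j = 2 / (2 * ((i : ℕ) + 1 : ℝ) + 2 * ((j : ℕ) + 1 : ℝ) - 3)) (k m : Fin n) :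
    (evenLegendreMatrix n * G) k m = ∑ i ∈ Finset.range ((k : ℕ) + 1),
      evenLegendreCoeff ((k : ℕ) + 1) (i + 1) / (((m : ℕ) : ℝ) + 1 / 2 + i) := by
  have hentry : ∀ i : Fin n, G i m = 1 / (((m : ℕ) : ℝ) + 1 / 2 + (i : ℕ)) := by
    intro i
    rw [hG, show (2 * ((i : ℕ) + 1 : ℝ) + 2 * ((m : ℕ) + 1 : ℝ) - 3) =
      2 * (((m : ℕ) : ℝ) + 1 / 2 + (i : ℕ)) by ring]
    field_simp
  simp only [Matrix.mul_apply, evenLegendreMatrix, Matrix.of_apply, hentry, mul_one_div]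
  rw [Fin.sum_univ_eq_sum_range
    (fun i => evenLegendreCoeff ((k : ℕ) + 1) (i + 1) / (((m : ℕ) : ℝ) + 1 / 2 + i))]
  refine (Finset.sum_subset (Finset.range_subset_range.mpr k.isLt) fun i _ hi => ?_).symm
  rw [evenLegendreCoeff_eq_zero (by simpa using hi), zero_div]

/-- Orthogonality of the even Legendre polynomials, in matrix form. -/
theorem evenLegendreMatrix_mul_gram_mul_transpose {n : ℕ} (G : Matrix (Fin n) (Fin n) ℝ)
    (hG : ∀ i j : Fin n,
      G i j = 2 / (2 * ((i : ℕ) + 1 : ℝ) + 2 * ((j : ℕ) + 1 : ℝ) - 3)) :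
    evenLegendreMatrix n * G * (evenLegendreMatrix n).transpose =
      Matrix.diagonal fun k : Fin n => 2 / (4 * ((k : ℕ) : ℝ) + 1) := by
  have hGt : G.transpose = G := by
    ext i j
    rw [Matrix.transpose_apply, hG, hG, add_comm (2 * _ : ℝ)]
  set S := evenLegendreMatrix n * G * (evenLegendreMatrix n).transpose with hS
  have hSt : S.transpose = S := by
    simp [hS, Matrix.transpose_mul, hGt, Matrix.mul_assoc]
  have hzero : ∀ k l m : Fin n, l ≤ k → m ≠ k →
      (evenLegendreMatrix n * G) k m * evenLegendreMatrix n l m = 0 := by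
    intro k l m hlk hmk
    rcases lt_or_gt_of_ne hmk with h | h
    · rw [evenLegendreMatrix_mul_gram_apply G hG, sum_evenLegendreCoeff_div_of_lt h, zero_mul]
    · rw [evenLegendreMatrix, Matrix.of_apply, evenLegendreCoeff_eq_zero (hlk.trans_lt h),
        mul_zero]
  have hlower : ∀ k l : Fin n, l ≤ k →
      S k l = (evenLegendreMatrix n * G) k k * evenLegendreMatrix n l k := by
    intro k l hlk
    rw [hS, Matrix.mul_apply]
    exact Finset.sum_eq_single k (fun m _ hm => hzero k l m hlk hm) (by simp)
  have hlt : ∀ k l : Fin n, l < k → S k l = 0 := by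
    intro k l hlk
    rw [hlower k l hlk.le, evenLegendreMatrix, Matrix.of_apply, evenLegendreCoeff_eq_zero hlk,
      mul_zero]
  ext k l
  rcases lt_trichotomy l k with h | rfl | h
  · rw [hlt k l h, Matrix.diagonal_apply_ne _ h.ne']
  · rw [hlower l l le_rfl, Matrix.diagonal_apply_eq, evenLegendreMatrix_mul_gram_apply G hG,
      mul_comm]
    exact evenLegendreCoeff_self_mul_sum l
  · rw [← hSt, Matrix.transpose_apply, hlt l k h, Matrix.diagonal_apply_ne _ h.ne]

/-- The inverse of the Gram matrix `G i j = 2/(2i + 2j − 3)` (indices running from `1` to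
`n`) of the even monomials `1, x², …, x^{2(n-1)}` on `(-1, 1)`:
`(G⁻¹) i j = ∑_{k ≥ max i j} ((4k−3)/2) a_{ki} a_{kj}`. -/
theorem evenLegendre_gram_inverse (n : ℕ) (hn : 1 ≤ n)
    (G : Matrix (Fin n) (Fin n) ℝ)
    (hG : ∀ i j : Fin n,
      G i j = 2 / (2 * ((i : ℕ) + 1 : ℝ) + 2 * ((j : ℕ) + 1 : ℝ) - 3)) :
    IsUnit G ∧
      ∀ i j : Fin n,
        G⁻¹ i j =
          ∑ k ∈ Finset.univ.filter (fun k : Fin n => max i j ≤ k),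
            ((4 * ((k : ℕ) + 1 : ℝ) - 3) / 2) *
              evenLegendreCoeff ((k : ℕ) + 1) ((i : ℕ) + 1) *
              evenLegendreCoeff ((k : ℕ) + 1) ((j : ℕ) + 1) := by
  set A := evenLegendreMatrix n
  set D : Matrix (Fin n) (Fin n) ℝ :=
    Matrix.diagonal fun k : Fin n => (4 * ((k : ℕ) : ℝ) + 1) / 2
  have hAD : A * (G * A.transpose * D) = 1 := by
    rw [← Matrix.mul_assoc, ← Matrix.mul_assoc, evenLegendreMatrix_mul_gram_mul_transpose G hG,
      Matrix.diagonal_mul_diagonal, ← Matrix.diagonal_one]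
    congr 1
    ext k
    have : (4 * ((k : ℕ) : ℝ) + 1) ≠ 0 := by positivity
    field_simp
  have hGB : G * (A.transpose * D * A) = 1 := by
    rw [← mul_eq_one_comm.mp hAD]
    simp only [Matrix.mul_assoc]
  refine ⟨IsUnit.of_mul_eq_one _ hGB, fun i j => ?_⟩
  rw [Matrix.inv_eq_right_inv hGB, Matrix.mul_apply, Finset.sum_filter]
  refine Finset.sum_congr rfl fun k _ => ?_
  rw [Matrix.mul_diagonal, Matrix.transpose_apply]
  simp only [A, evenLegendreMatrix, Matrix.of_apply]
  split_ifs with h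
  · ring
  · rcases lt_max_iff.mp (not_le.mp h) with h | h <;> simp [evenLegendreCoeff_eq_zero h]
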